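/- Let f, g : X → Y and f', g' : X' → Y' be continuous maps, and assume that the product space X × X' is normal. Then the product maps f × f', g × g' : X × X' → Y × Y', defined by (f × f')(x,x') = (f(x), f'(x')) and (g × g')(x,x') = (g(x), g'(x')), satisfy D(f × f', g × g') ≤ D(f, g) + D(f', g'). -/

import Mathlib

open ContinuousMap

/-- The homotopic distance between two continuous maps `f g : C(X, Y)`:
the least `n : ℕ∞` such that `X` admits an open cover by `n + 1` sets on each of
which the restrictions of `f` and `g` are homotopic; `⊤` if no such cover exists. -/
noncomputable def homotopicDistance {X Y : Type*} [TopologicalSpace X] [TopologicalSpace Y]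
    (f g : C(X, Y)) : ℕ∞ :=
  sInf ((Nat.cast : ℕ → ℕ∞) '' {n : ℕ | ∃ U : Fin (n + 1) → Set X,
    (∀ j, IsOpen (U j)) ∧ (⋃ j, U j) = Set.univ ∧
    ∀ j, (f.restrict (U j)).Homotopic (g.restrict (U j))})

/-- The (normalized) Lusternik–Schnirelmann category of a space `X`: the least
`n : ℕ∞` such that `X` admits an open cover by `n + 1` sets on each of which the
inclusion into `X` is null-homotopic. -/
noncomputable def lsCat (X : Type*) [TopologicalSpace X] : ℕ∞ :=
  sInf ((Nat.cast : ℕ → ℕ∞) '' {n : ℕ | ∃ U : Fin (n + 1) → Set X,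
    (∀ j, IsOpen (U j)) ∧ (⋃ j, U j) = Set.univ ∧
    ∀ j, ∃ y : X, ((ContinuousMap.id X).restrict (U j)).Homotopic
      (ContinuousMap.const (U j) y)})

open scoped unitInterval

section Restriction

variable {X Y Z : Type*} [TopologicalSpace X] [TopologicalSpace Y] [TopologicalSpace Z]

/-- Homotopies between restrictions, described by functions on the whole cylinder that are
continuous over the subset. -/
theorem homotopic_restrict_iff {f g : C(X, Y)} {U : Set X} :
    (f.restrict U).Homotopic (g.restrict U) ↔
      ∃ F : I × X → Y, ContinuousOn F (Set.univ ×ˢ U) ∧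
        (∀ x ∈ U, F (0, x) = f x) ∧ ∀ x ∈ U, F (1, x) = g x := by
  classical
  constructor
  · rintro ⟨H⟩
    refine ⟨fun p => if h : p.2 ∈ U then H (p.1, ⟨p.2, h⟩) else f p.2, ?_, ?_, ?_⟩
    · rw [continuousOn_iff_continuous_domRestrict]
      have hc : Continuous fun p : (Set.univ ×ˢ U : Set (I × X)) =>
          H (p.1.1, ⟨p.1.2, p.2.2⟩) := by fun_prop
      refine hc.congr fun p => ?_
      have hp : p.1.2 ∈ U := p.2.2
      simp [hp]
    · intro x hx
      simp [hx]
    · intro x hx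
      simp [hx]
  · rintro ⟨F, hF, h0, h1⟩
    exact ⟨{ toFun := fun p => F (p.1, p.2)
             continuous_toFun := hF.comp_continuous (by fun_prop) fun p => ⟨trivial, p.2.2⟩
             map_zero_left := fun x => h0 x x.2
             map_one_left := fun x => h1 x x.2 }⟩

theorem homotopic_restrict_mono {f g : C(X, Y)} {U V : Set X} (hVU : V ⊆ U)
    (h : (f.restrict U).Homotopic (g.restrict U)) :
    (f.restrict V).Homotopic (g.restrict V) := by
  rw [homotopic_restrict_iff] at h ⊢
  obtain ⟨F, hF, h0, h1⟩ := h
  exact ⟨F, hF.mono (Set.prod_mono_right hVU), fun x hx => h0 x (hVU hx),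
    fun x hx => h1 x (hVU hx)⟩

theorem homotopic_restrict_comp {f g : C(X, Y)} {U : Set X} (q : C(Z, X))
    (h : (f.restrict U).Homotopic (g.restrict U)) :
    ((f.comp q).restrict (q ⁻¹' U)).Homotopic ((g.comp q).restrict (q ⁻¹' U)) := by
  rw [homotopic_restrict_iff] at h ⊢
  obtain ⟨F, hF, h0, h1⟩ := h
  refine ⟨fun p => F (p.1, q p.2), ?_, fun x hx => h0 _ hx, fun x hx => h1 _ hx⟩
  exact hF.comp (by fun_prop) fun p hp => ⟨trivial, hp.2⟩

/-- Homotopies over pairwise disjoint open sets glue to a homotopy over their union. -/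
theorem homotopic_restrict_iUnion {ι : Type*} {f g : C(X, Y)} {O : ι → Set X}
    (hO : ∀ i, IsOpen (O i)) (hd : Pairwise fun i j => Disjoint (O i) (O j))
    (h : ∀ i, (f.restrict (O i)).Homotopic (g.restrict (O i))) :
    (f.restrict (⋃ i, O i)).Homotopic (g.restrict (⋃ i, O i)) := by
  classical
  simp only [homotopic_restrict_iff] at h ⊢
  choose F hF h0 h1 using h
  let G : I × X → Y := fun p => if hp : ∃ i, p.2 ∈ O i then F hp.choose p else f p.2
  have hG : ∀ i, ∀ p : I × X, p.2 ∈ O i → G p = F i p := by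
    intro i p hp
    have he : ∃ i, p.2 ∈ O i := ⟨i, hp⟩
    have hi : he.choose = i := by
      by_contra hne
      exact Set.disjoint_left.1 (hd hne) he.choose_spec hp
    simp only [G, dif_pos he, hi]
  refine ⟨G, ?_, ?_, ?_⟩
  · rintro p ⟨-, hp⟩
    obtain ⟨i, hi⟩ := Set.mem_iUnion.1 hp
    have hopen : IsOpen (Set.univ ×ˢ O i : Set (I × X)) := isOpen_univ.prod (hO i)
    have hmem : p ∈ (Set.univ ×ˢ O i : Set (I × X)) := ⟨trivial, hi⟩
    refine ContinuousAt.continuousWithinAt ?_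
    refine ((hF i).continuousAt (hopen.mem_nhds hmem)).congr ?_
    filter_upwards [hopen.mem_nhds hmem] with q hq using (hG i q hq.2).symm
  · intro x hx
    obtain ⟨i, hi⟩ := Set.mem_iUnion.1 hx
    rw [hG i _ hi, h0 i x hi]
  · intro x hx
    obtain ⟨i, hi⟩ := Set.mem_iUnion.1 hx
    rw [hG i _ hi, h1 i x hi]

theorem homotopic_restrict_prodMap {X' Y' : Type*} [TopologicalSpace X'] [TopologicalSpace Y']
    {f g : C(X, Y)} {f' g' : C(X', Y')} {W : Set (X × X')}
    (h : ((f.comp ContinuousMap.fst).restrict W).Homotopic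
      ((g.comp ContinuousMap.fst).restrict W))
    (h' : ((f'.comp ContinuousMap.snd).restrict W).Homotopic
      ((g'.comp ContinuousMap.snd).restrict W)) :
    ((f.prodMap f').restrict W).Homotopic ((g.prodMap g').restrict W) :=
  h.prodMk h'

end Restriction

/-- In a pseudo-emetric space, the intersections `U i ∩ V j` contain open sets `O (i, j)` which
cover the same set and are disjoint for distinct pairs with the same sum `i + j`. -/
theorem exists_open_refinement_disjoint_of_pseudoEMetric {E : Type*} [PseudoEMetricSpace E]
    {m n : ℕ} {U : Fin m → Set E} {V : Fin n → Set E}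
    (hU : ∀ i, IsOpen (U i)) (hV : ∀ j, IsOpen (V j)) :
    ∃ O : Fin m × Fin n → Set E, (∀ p, IsOpen (O p)) ∧ (∀ p, O p ⊆ U p.1 ∩ V p.2) ∧
      (⋃ i, U i) ∩ (⋃ j, V j) ⊆ ⋃ p, O p ∧
      ∀ p q, p ≠ q → (p.1 + p.2 : ℕ) = q.1 + q.2 → Disjoint (O p) (O q) := by
  classical
  let P : Fin m × Fin n → Set E := fun p =>
    {x | x ∈ U p.1 ∧ x ∈ V p.2 ∧ (∀ i < p.1, x ∉ U i) ∧ ∀ j < p.2, x ∉ V j}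
  have hsep : ∀ p q, p ≠ q → (p.1 + p.2 : ℕ) = q.1 + q.2 → ∀ x ∈ P p, x ∉ closure (P q) := by
    intro p q hne hs x hx hxq
    rcases lt_trichotomy p.1 q.1 with h | h | h
    · obtain ⟨y, hy, hyq⟩ := mem_closure_iff.1 hxq _ (hU p.1) hx.1
      exact hyq.2.2.1 _ h hy
    · refine hne (Prod.ext h (Fin.ext ?_))
      rw [h] at hs
      omega
    · have h2 : p.2 < q.2 := by
        rw [Fin.lt_def] at h ⊢
        omega
      obtain ⟨y, hy, hyq⟩ := mem_closure_iff.1 hxq _ (hV p.2) hx.2.1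
      exact hyq.2.2.2 _ h2 hy
  let N : Fin m × Fin n → Fin m × Fin n → Set E := fun p q =>
    if p ≠ q ∧ (p.1 + p.2 : ℕ) = q.1 + q.2 then
      {x | Metric.infEDist x (P p) < Metric.infEDist x (P q)} else Set.univ
  refine ⟨fun p => (U p.1 ∩ V p.2) ∩ ⋂ q, N p q, fun p => ?_, fun p => Set.inter_subset_left,
    ?_, ?_⟩
  · refine ((hU _).inter (hV _)).inter (isOpen_iInter_of_finite fun q => ?_)
    by_cases h : p ≠ q ∧ (p.1 + p.2 : ℕ) = q.1 + q.2
    · simp only [N, if_pos h]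
      exact isOpen_lt Metric.continuous_infEDist Metric.continuous_infEDist
    · simp only [N, if_neg h, isOpen_univ]
  · rintro x ⟨hxU, hxV⟩
    obtain ⟨i, hi, hi'⟩ := WellFounded.has_min (wellFounded_lt (α := Fin m)) {i | x ∈ U i}
      (Set.mem_iUnion.1 hxU)
    obtain ⟨j, hj, hj'⟩ := WellFounded.has_min (wellFounded_lt (α := Fin n)) {j | x ∈ V j}
      (Set.mem_iUnion.1 hxV)
    have hxP : x ∈ P (i, j) :=
      ⟨hi, hj, fun k hk hxk => hi' k hxk hk, fun k hk hxk => hj' k hxk hk⟩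
    refine Set.mem_iUnion.2 ⟨(i, j), ⟨hi, hj⟩, Set.mem_iInter.2 fun q => ?_⟩
    by_cases h : (i, j) ≠ q ∧ (((i, j) : Fin m × Fin n).1 + ((i, j) : Fin m × Fin n).2 : ℕ)
        = q.1 + q.2
    · simp only [N, if_pos h]
      have hx := hsep _ q h.1 h.2 x hxP
      rw [Metric.mem_closure_iff_infEDist_zero] at hx
      rw [Set.mem_ofPred_eq, Metric.infEDist_zero_of_mem hxP]
      exact pos_iff_ne_zero.2 hx
    · simp only [N, if_neg h, Set.mem_univ]
  · intro p q hne hs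
    refine Set.disjoint_left.2 fun x hxp hxq => ?_
    have h1 := Set.mem_iInter.1 hxp.2 q
    have h2 := Set.mem_iInter.1 hxq.2 p
    simp only [N, if_pos (And.intro hne hs), Set.mem_ofPred_eq] at h1
    simp only [N, if_pos (And.intro hne.symm hs.symm), Set.mem_ofPred_eq] at h2
    exact lt_asymm h1 h2

/-- A finite open cover of a normal space is refined by the positivity sets of continuous
real functions. -/
theorem exists_continuous_pos_of_iUnion_eq_univ {ι Z : Type*} [Finite ι] [TopologicalSpace Z]
    [NormalSpace Z] {U : ι → Set Z} (hU : ∀ i, IsOpen (U i)) (hcov : ⋃ i, U i = Set.univ) :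
    ∃ φ : ι → C(Z, ℝ), (∀ i z, 0 < φ i z → z ∈ U i) ∧ ∀ z, ∃ i, 0 < φ i z := by
  obtain ⟨K, hK, hKc, hKU⟩ := exists_iUnion_eq_closed_subset hU (fun _ => Set.toFinite _) hcov
  have hφ : ∀ i, ∃ φ : C(Z, ℝ), Set.EqOn φ 0 (U i)ᶜ ∧ Set.EqOn φ 1 (K i) := fun i => by
    obtain ⟨φ, h0, h1, -⟩ := exists_continuous_zero_one_of_isClosed (hU i).isClosed_compl (hKc i)
      (Set.disjoint_left.2 fun x hx hxK => hx (hKU i hxK))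
    exact ⟨φ, h0, h1⟩
  choose φ h0 h1 using hφ
  refine ⟨φ, fun i z hz => ?_, fun z => ?_⟩
  · by_contra hzU
    rw [h0 i hzU] at hz
    exact lt_irrefl _ hz
  · obtain ⟨i, hi⟩ := Set.mem_iUnion.1 (hK.symm ▸ Set.mem_univ z : z ∈ ⋃ i, K i)
    refine ⟨i, ?_⟩
    rw [h1 i hi]
    exact one_pos

/-- In a normal space, two finite open covers `U` and `V` have a common open refinement `O (i, j)`
whose members are disjoint for distinct pairs with the same sum `i + j`. -/
theorem exists_open_refinement_disjoint {Z : Type*} [TopologicalSpace Z] [NormalSpace Z]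
    {m n : ℕ} {U : Fin m → Set Z} {V : Fin n → Set Z}
    (hU : ∀ i, IsOpen (U i)) (hV : ∀ j, IsOpen (V j))
    (hUc : ⋃ i, U i = Set.univ) (hVc : ⋃ j, V j = Set.univ) :
    ∃ O : Fin m × Fin n → Set Z, (∀ p, IsOpen (O p)) ∧ (∀ p, O p ⊆ U p.1 ∩ V p.2) ∧
      ⋃ p, O p = Set.univ ∧
      ∀ p q, p ≠ q → (p.1 + p.2 : ℕ) = q.1 + q.2 → Disjoint (O p) (O q) := by
  obtain ⟨φ, hφ, hφc⟩ := exists_continuous_pos_of_iUnion_eq_univ hU hUc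
  obtain ⟨ψ, hψ, hψc⟩ := exists_continuous_pos_of_iUnion_eq_univ hV hVc
  obtain ⟨O, hO, hOs, hOc, hOd⟩ := exists_open_refinement_disjoint_of_pseudoEMetric
    (E := (Fin m → ℝ) × (Fin n → ℝ)) (U := fun i => {x | 0 < x.1 i})
    (V := fun j => {x | 0 < x.2 j})
    (fun i => isOpen_lt continuous_const (by fun_prop))
    (fun j => isOpen_lt continuous_const (by fun_prop))
  let Φ : Z → (Fin m → ℝ) × (Fin n → ℝ) := fun z => (fun i => φ i z, fun j => ψ j z)
  have hΦ : Continuous Φ := by fun_prop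
  refine ⟨fun p => Φ ⁻¹' O p, fun p => (hO p).preimage hΦ, fun p z hz => ?_, ?_,
    fun p q hne hs => (hOd p q hne hs).preimage Φ⟩
  · exact ⟨hφ _ _ (hOs p hz).1, hψ _ _ (hOs p hz).2⟩
  · refine Set.eq_univ_of_forall fun z => ?_
    rw [← Set.preimage_iUnion]
    exact hOc ⟨Set.mem_iUnion.2 (hφc z), Set.mem_iUnion.2 (hψc z)⟩

theorem exists_cover_of_homotopicDistance_ne_top {X Y : Type*} [TopologicalSpace X]
    [TopologicalSpace Y] {f g : C(X, Y)} (h : homotopicDistance f g ≠ ⊤) :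
    ∃ n : ℕ, homotopicDistance f g = n ∧ ∃ U : Fin (n + 1) → Set X,
      (∀ j, IsOpen (U j)) ∧ (⋃ j, U j) = Set.univ ∧
      ∀ j, (f.restrict (U j)).Homotopic (g.restrict (U j)) := by
  obtain ⟨n, hn, hn'⟩ := csInf_mem <| Set.nonempty_iff_ne_empty.2 fun he =>
    h (show homotopicDistance f g = ⊤ from (congrArg sInf he).trans sInf_empty)
  exact ⟨n, hn'.symm, hn⟩

/-- if `X × X'` is normal, then
`D(f × f', g × g') ≤ D(f, g) + D(f', g')`. -/
theorem homotopicDistance_prodMap_le {X Y X' Y' : Type*} [TopologicalSpace X]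
    [TopologicalSpace Y] [TopologicalSpace X'] [TopologicalSpace Y']
    [NormalSpace (X × X')] (f g : C(X, Y)) (f' g' : C(X', Y')) :
    homotopicDistance (f.prodMap f') (g.prodMap g') ≤
      homotopicDistance f g + homotopicDistance f' g' := by
  by_cases h : homotopicDistance f g = ⊤
  · simp [h]
  by_cases h' : homotopicDistance f' g' = ⊤
  · simp [h']
  obtain ⟨m, hm, U, hU, hUc, hUH⟩ := exists_cover_of_homotopicDistance_ne_top h
  obtain ⟨n, hn, V, hV, hVc, hVH⟩ := exists_cover_of_homotopicDistance_ne_top h'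
  obtain ⟨O, hO, hOs, hOc, hOd⟩ := exists_open_refinement_disjoint (Z := X × X')
    (U := fun i => Prod.fst ⁻¹' U i) (V := fun j => Prod.snd ⁻¹' V j)
    (fun i => (hU i).preimage continuous_fst) (fun j => (hV j).preimage continuous_snd)
    (by rw [← Set.preimage_iUnion, hUc, Set.preimage_univ])
    (by rw [← Set.preimage_iUnion, hVc, Set.preimage_univ])
  rw [hm, hn]
  refine sInf_le ⟨m + n, ⟨fun k => ⋃ p : {p : Fin (m + 1) × Fin (n + 1) //
    (p.1 + p.2 : ℕ) = k}, O p, fun k => isOpen_iUnion fun p => hO p, ?_, fun k => ?_⟩, by simp⟩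
  · refine Set.eq_univ_of_forall fun z => ?_
    obtain ⟨p, hp⟩ := Set.mem_iUnion.1 (hOc.symm ▸ Set.mem_univ z : z ∈ ⋃ p, O p)
    exact Set.mem_iUnion.2 ⟨⟨p.1 + p.2, by omega⟩, Set.mem_iUnion.2 ⟨⟨p, rfl⟩, hp⟩⟩
  · have hd : Pairwise fun p q : {p : Fin (m + 1) × Fin (n + 1) // (p.1 + p.2 : ℕ) = k} =>
        Disjoint (O p) (O q) := fun p q hpq =>
      hOd p q (fun he => hpq (Subtype.ext he)) (p.2.trans q.2.symm)
    refine homotopic_restrict_prodMap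
      (homotopic_restrict_iUnion (fun p => hO p) hd fun p => ?_)
      (homotopic_restrict_iUnion (fun p => hO p) hd fun p => ?_)
    · exact homotopic_restrict_mono (fun z hz => (hOs p hz).1)
        (homotopic_restrict_comp ContinuousMap.fst (hUH p.1.1))
    · exact homotopic_restrict_mono (fun z hz => (hOs p hz).2)
        (homotopic_restrict_comp ContinuousMap.snd (hVH p.1.2))
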